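/- Let Q be a positive quantum channel (Q(X) = ∑ᵢ Aᵢ X Aᵢ* with ∑ᵢ Aᵢ* Aᵢ = I and a(Q) > 0) that is unital (Q(I/n) = I/n). Then the linear map P = Q' ∘ Q restricted to the space H_{n,0} of trace-zero Hermitian matrices is self-adjoint positive semidefinite with respect to the Hilbert–Schmidt inner product, and its operator norm satisfies ‖P‖ = ρ(P) < 1. -/

import Mathlib

open Matrix
open scoped ComplexOrder

/-- Frobenius norm of a complex matrix. -/
noncomputable def frobNorm {n : ℕ} (W : Matrix (Fin n) (Fin n) ℂ) : ℝ :=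
  Real.sqrt ((W * Wᴴ).trace.re)

/-- A linear map that strictly decreases the norm on a finite-dimensional subspace is a strict
contraction there. -/
theorem LinearMap.exists_lt_one_forall_norm_le {E F : Type*} [NormedAddCommGroup E]
    [NormedSpace ℝ E] [FiniteDimensional ℝ E] [NormedAddCommGroup F] [NormedSpace ℝ F]
    (T : E →ₗ[ℝ] F) (hT : ∀ x, x ≠ 0 → ‖T x‖ < ‖x‖) :
    ∃ c : ℝ, c < 1 ∧ ∀ x, ‖T x‖ ≤ c * ‖x‖ := by
  have : ProperSpace E := FiniteDimensional.proper ℝ E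
  rcases subsingleton_or_nontrivial E with hE | hE
  · exact ⟨0, one_pos, fun x => by simp [Subsingleton.elim x 0]⟩
  have hcont : Continuous fun x => ‖T x‖ := T.continuous_of_finiteDimensional.norm
  obtain ⟨x₀, hx₀, hmax⟩ := (isCompact_sphere (0 : E) 1).exists_isMaxOn
    (NormedSpace.sphere_nonempty.2 zero_le_one) hcont.continuousOn
  rw [mem_sphere_zero_iff_norm] at hx₀
  refine ⟨‖T x₀‖, hx₀ ▸ hT x₀ (by rintro rfl; simp at hx₀), fun x => ?_⟩
  rcases eq_or_ne x 0 with rfl | hx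
  · simp
  have hx' : 0 < ‖x‖ := norm_pos_iff.2 hx
  have h : ‖T (‖x‖⁻¹ • x)‖ ≤ ‖T x₀‖ := hmax (by simp [norm_smul, hx'.ne'])
  rw [map_smul, norm_smul, norm_inv, norm_norm, inv_mul_le_iff₀ hx'] at h
  linarith

theorem trace_mul_conjTranspose_re_nonneg {n : ℕ} (M : Matrix (Fin n) (Fin n) ℂ) :
    0 ≤ (M * Mᴴ).trace.re :=
  (Complex.le_def.1 (posSemidef_self_mul_conjTranspose M).trace_nonneg).1

section Frobenius

attribute [local instance] Matrix.frobeniusNormedAddCommGroup Matrix.frobeniusNormedSpace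

theorem frobNorm_eq_norm {n : ℕ} (W : Matrix (Fin n) (Fin n) ℂ) : frobNorm W = ‖W‖ := by
  rw [frobNorm, Matrix.frobenius_norm_def, Real.sqrt_eq_rpow]
  congr 1
  simp [Matrix.trace, Matrix.mul_apply, Complex.mul_conj, Complex.normSq_eq_norm_sq,
    -Complex.ofReal_pow]

/-- A real-linear map that strictly decreases the Frobenius norm of every nonzero trace-zero
Hermitian matrix is a strict contraction on these matrices. -/
theorem exists_lt_one_forall_frobNorm_le {n : ℕ}
    (T : Matrix (Fin n) (Fin n) ℂ →ₗ[ℝ] Matrix (Fin n) (Fin n) ℂ)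
    (hT : ∀ W, W.IsHermitian → W.trace = 0 → W ≠ 0 → frobNorm (T W) < frobNorm W) :
    ∃ c : ℝ, c < 1 ∧ ∀ W, W.IsHermitian → W.trace = 0 →
      frobNorm (T W) ≤ c * frobNorm W := by
  let S : Submodule ℝ (Matrix (Fin n) (Fin n) ℂ) :=
    selfAdjoint.submodule ℝ _ ⊓ LinearMap.ker (Matrix.traceLinearMap (Fin n) ℝ ℂ)
  obtain ⟨c, hc, h⟩ := (T ∘ₗ S.subtype).exists_lt_one_forall_norm_le (fun x hx => by
    have := hT x x.2.1 x.2.2 (by simpa using hx)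
    rwa [frobNorm_eq_norm, frobNorm_eq_norm] at this)
  refine ⟨c, hc, fun W hW hW' => ?_⟩
  rw [frobNorm_eq_norm, frobNorm_eq_norm]
  exact h ⟨W, hW, hW'⟩

end Frobenius

/-- The completely positive map with Kraus operators `A`, as a real-linear map. -/
def krausMap {n k : ℕ} (A : Fin k → Matrix (Fin n) (Fin n) ℂ) :
    Matrix (Fin n) (Fin n) ℂ →ₗ[ℝ] Matrix (Fin n) (Fin n) ℂ where
  toFun W := ∑ i, A i * W * (A i)ᴴ
  map_add' W V := by simp [mul_add, add_mul, Finset.sum_add_distrib]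
  map_smul' r W := by simp [Finset.smul_sum]

section Kraus

variable {n k : ℕ} (A : Fin k → Matrix (Fin n) (Fin n) ℂ)

theorem krausMap_apply (W : Matrix (Fin n) (Fin n) ℂ) :
    krausMap A W = ∑ i, A i * W * (A i)ᴴ := rfl

theorem krausMap_conjTranspose (W : Matrix (Fin n) (Fin n) ℂ) :
    krausMap A Wᴴ = (krausMap A W)ᴴ := by
  simp [krausMap_apply, Matrix.conjTranspose_sum, Matrix.mul_assoc]

theorem trace_krausMap_mul (W V : Matrix (Fin n) (Fin n) ℂ) :
    (krausMap A W * V).trace = (W * krausMap (fun i => (A i)ᴴ) V).trace := by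
  simp only [krausMap_apply, Finset.sum_mul, Finset.mul_sum, Matrix.trace_sum,
    conjTranspose_conjTranspose]
  refine Finset.sum_congr rfl fun i _ => ?_
  rw [Matrix.mul_assoc, Matrix.mul_assoc, Matrix.trace_mul_comm]
  simp only [Matrix.mul_assoc]

variable {A}

theorem trace_krausMap (hA : ∑ i, (A i)ᴴ * A i = 1) (W : Matrix (Fin n) (Fin n) ℂ) :
    (krausMap A W).trace = W.trace := by
  have h := trace_krausMap_mul A W 1
  simpa [krausMap_apply (fun i => (A i)ᴴ), hA] using h

/-- The defect in the Kadison inequality for a unital Kraus map. -/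
theorem sum_commutator_mul_conjTranspose (hA : ∑ i, A i * (A i)ᴴ = 1)
    {W : Matrix (Fin n) (Fin n) ℂ} (hW : W.IsHermitian) :
    ∑ i, (A i * W - krausMap A W * A i) * (A i * W - krausMap A W * A i)ᴴ =
      krausMap A (W * Wᴴ) - krausMap A W * (krausMap A W)ᴴ := by
  have hB : (krausMap A W)ᴴ = krausMap A W := by rw [← krausMap_conjTranspose, hW.eq]
  have h (i : Fin k) : (A i * W - krausMap A W * A i) * (A i * W - krausMap A W * A i)ᴴ =
      A i * (W * W) * (A i)ᴴ - A i * W * (A i)ᴴ * krausMap A W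
        - krausMap A W * (A i * W * (A i)ᴴ)
        + krausMap A W * (A i * (A i)ᴴ) * krausMap A W := by
    simp only [conjTranspose_sub, conjTranspose_mul, hB, hW.eq]
    noncomm_ring
  simp only [h, Finset.sum_add_distrib, Finset.sum_sub_distrib, ← Finset.sum_mul,
    ← Finset.mul_sum, hA, ← krausMap_apply, hB, hW.eq]
  noncomm_ring

theorem sum_trace_commutator_re (hA : ∑ i, (A i)ᴴ * A i = 1) (hA' : ∑ i, A i * (A i)ᴴ = 1)
    {W : Matrix (Fin n) (Fin n) ℂ} (hW : W.IsHermitian) :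
    ∑ i, ((A i * W - krausMap A W * A i) * (A i * W - krausMap A W * A i)ᴴ).trace.re =
      (W * Wᴴ).trace.re - (krausMap A W * (krausMap A W)ᴴ).trace.re := by
  rw [← trace_krausMap hA (W * Wᴴ), ← Complex.sub_re, ← Matrix.trace_sub,
    ← sum_commutator_mul_conjTranspose hA' hW, Matrix.trace_sum, Complex.re_sum]

theorem frobNorm_krausMap_le (hA : ∑ i, (A i)ᴴ * A i = 1) (hA' : ∑ i, A i * (A i)ᴴ = 1)
    {W : Matrix (Fin n) (Fin n) ℂ} (hW : W.IsHermitian) :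
    frobNorm (krausMap A W) ≤ frobNorm W := by
  refine Real.sqrt_le_sqrt (sub_nonneg.1 ?_)
  rw [← sum_trace_commutator_re hA hA' hW]
  exact Finset.sum_nonneg fun i _ => trace_mul_conjTranspose_re_nonneg _

theorem mul_eq_krausMap_mul_of_frobNorm_le (hA : ∑ i, (A i)ᴴ * A i = 1)
    (hA' : ∑ i, A i * (A i)ᴴ = 1) {W : Matrix (Fin n) (Fin n) ℂ} (hW : W.IsHermitian)
    (h : frobNorm W ≤ frobNorm (krausMap A W)) (i : Fin k) :
    A i * W = krausMap A W * A i := by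
  have h' := (Real.sqrt_le_sqrt_iff (trace_mul_conjTranspose_re_nonneg _)).1 h
  rw [← sub_nonpos, ← sum_trace_commutator_re hA hA' hW] at h'
  have h0 := (Finset.sum_eq_zero_iff_of_nonneg
    fun i _ => trace_mul_conjTranspose_re_nonneg _).1
    (h'.antisymm (Finset.sum_nonneg fun i _ => trace_mul_conjTranspose_re_nonneg _))
    i (Finset.mem_univ i)
  have hnn := (posSemidef_self_mul_conjTranspose
    (A i * W - krausMap A W * A i)).trace_nonneg
  rw [← sub_eq_zero, ← Matrix.trace_mul_conjTranspose_self_eq_zero_iff]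
  exact Complex.ext h0 (Complex.le_def.1 hnn).2.symm

theorem frobNorm_krausMap_lt (hn : 0 < n) (hA : ∑ i, (A i)ᴴ * A i = 1)
    (hA' : ∑ i, A i * (A i)ᴴ = 1)
    (hpos : ∀ X : Matrix (Fin n) (Fin n) ℂ, X.PosSemidef → X.trace = 1 →
      (krausMap A X).PosDef)
    {W : Matrix (Fin n) (Fin n) ℂ} (hW : W.IsHermitian) (htr : W.trace = 0) (hW0 : W ≠ 0) :
    frobNorm (krausMap A W) < frobNorm W := by
  by_contra! h
  have hcomm := mul_eq_krausMap_mul_of_frobNorm_le hA hA' hW h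
  refine hW0 (hW.eigenvalues_eq_zero_iff.1 (funext fun j => ?_))
  set x : Fin n → ℂ := ⇑(hW.eigenvectorBasis j) with hx
  set c : ℂ := (hW.eigenvalues j : ℂ) with hc
  have hWx : W * vecMulVec x (star x) = c • vecMulVec x (star x) := by
    rw [mul_vecMulVec, hW.mulVec_eigenvectorBasis j, ← smul_vecMulVec]
    rfl
  have htrx : (vecMulVec x (star x)).trace = 1 := by
    rw [trace_vecMulVec]
    have h1 := hW.eigenvectorBasis.inner_eq_one j
    rw [EuclideanSpace.inner_eq_star_dotProduct] at h1
    exact h1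
  have hunit := (hpos _ (posSemidef_vecMulVec_self_star x) htrx).isUnit
  have hBX : krausMap A W * krausMap A (vecMulVec x (star x)) =
      (c • (1 : Matrix (Fin n) (Fin n) ℂ)) * krausMap A (vecMulVec x (star x)) := by
    rw [krausMap_apply A (vecMulVec x (star x)), Finset.mul_sum, Finset.mul_sum]
    refine Finset.sum_congr rfl fun i _ => ?_
    rw [← Matrix.mul_assoc, ← Matrix.mul_assoc, ← hcomm i, Matrix.mul_assoc (A i), hWx]
    simp
  have hB := hunit.mul_right_cancel hBX
  have ht := trace_krausMap hA W
  rw [hB, htr, trace_smul, trace_one, smul_eq_mul, Fintype.card_fin] at ht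
  have hn' : (n : ℂ) ≠ 0 := Nat.cast_ne_zero.2 hn.ne'
  simpa [hc, hn'] using ht

end Kraus

theorem stmt19 {n k : ℕ} (hn : 0 < n) (A : Fin k → Matrix (Fin n) (Fin n) ℂ)
    (hchan : ∑ i, (A i)ᴴ * A i = 1)
    (hpos : ∀ X : Matrix (Fin n) (Fin n) ℂ, X.PosSemidef → X.trace = 1 →
      (∑ i, A i * X * (A i)ᴴ).PosDef)
    (hunital : ∑ i, A i * (((1 : ℂ) / n) • (1 : Matrix (Fin n) (Fin n) ℂ)) * (A i)ᴴ =
      ((1 : ℂ) / n) • (1 : Matrix (Fin n) (Fin n) ℂ))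
    (P : Matrix (Fin n) (Fin n) ℂ → Matrix (Fin n) (Fin n) ℂ)
    (hP : P = fun W => ∑ i, (A i)ᴴ * (∑ j, A j * W * (A j)ᴴ) * A i) :
    (∀ W V : Matrix (Fin n) (Fin n) ℂ,
      W.IsHermitian → W.trace = 0 → V.IsHermitian → V.trace = 0 →
        (P W * Vᴴ).trace = (W * (P V)ᴴ).trace) ∧
    (∀ W : Matrix (Fin n) (Fin n) ℂ, W.IsHermitian → W.trace = 0 →
        0 ≤ ((P W) * Wᴴ).trace.re) ∧
    (∃ c : ℝ, c < 1 ∧ ∀ W : Matrix (Fin n) (Fin n) ℂ, W.IsHermitian → W.trace = 0 →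
        frobNorm (P W) ≤ c * frobNorm W) := by
  have hn' : (n : ℂ) ≠ 0 := Nat.cast_ne_zero.2 hn.ne'
  have hA' : ∑ i, A i * (A i)ᴴ = 1 := by
    simp only [Matrix.mul_smul, Matrix.smul_mul, mul_one, ← Finset.smul_sum] at hunital
    exact smul_right_injective _ (one_div_ne_zero hn') hunital
  have hPA : P = krausMap (fun i => (A i)ᴴ) ∘ₗ krausMap A := by
    rw [hP]
    funext W
    simp only [LinearMap.coe_comp, Function.comp_apply, krausMap_apply,
      conjTranspose_conjTranspose]
  subst hPA
  have hadj (W V : Matrix (Fin n) (Fin n) ℂ) :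
      (krausMap (fun i => (A i)ᴴ) W * V).trace = (W * krausMap A V).trace := by
    simpa using trace_krausMap_mul (fun i => (A i)ᴴ) W V
  refine ⟨fun W V _ _ _ _ => ?_, fun W _ _ => ?_, exists_lt_one_forall_frobNorm_le _
    fun W hW htr hW0 => ?_⟩
  · simp only [LinearMap.comp_apply, hadj, ← krausMap_conjTranspose, trace_krausMap_mul]
  · simp only [LinearMap.comp_apply, hadj, krausMap_conjTranspose]
    exact trace_mul_conjTranspose_re_nonneg _
  · have hB : (krausMap A W).IsHermitian := by
      rw [Matrix.IsHermitian, ← krausMap_conjTranspose, hW.eq]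
    have hle : frobNorm (krausMap (fun i => (A i)ᴴ) (krausMap A W)) ≤ frobNorm (krausMap A W) :=
      frobNorm_krausMap_le (by simpa using hA') (by simpa using hchan) hB
    exact hle.trans_lt
      (frobNorm_krausMap_lt hn hchan hA' hpos hW htr hW0)
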